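/- arXiv:1212.4163 — 9 statements merged into one kernel-verified Lean document; each statement's English description precedes it below -/
import Mathlib

section
/- Let n ≥ 1, let λ_1, …, λ_n be real numbers, and let φ : ℤ → ℝ. Then for every y : ℤ → ℝ and every t ∈ ℤ, ∑_{k=0}^n α_k (M_k y)(t) = ((φΔ − λ_n I) ∘ (φΔ − λ_{n−1} I) ∘ ⋯ ∘ (φΔ − λ_1 I) y)(t), where for a function z : ℤ → ℝ the operator (φΔ − λ I) is defined by ((φΔ − λ I)z)(t) = φ(t)·(z(t+1) − z(t)) − λ·z(t) and I is the identity operator. (This is the factorization lemma of the paper, specialized to the time scale ℤ.) -/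
/-- The Cauchy–Euler operators on the time scale ℤ:
`Mz 0 y = y`, `(Mz (k+1) y) t = φ t · Δ(Mz k y) t` where `Δz t = z (t+1) - z t`. -/
def Mz (φ : ℤ → ℝ) : ℕ → (ℤ → ℝ) → (ℤ → ℝ)
  | 0, y => y
  | (k+1), y => fun t => φ t * (Mz φ k y (t + 1) - Mz φ k y t)

/-- `alpha n lam k = e_{n-k}(-lam 1, …, -lam n)`, the `(n-k)`-th elementary
symmetric polynomial evaluated at `-lam 1, …, -lam n`. -/
noncomputable def alpha (n : ℕ) (lam : ℕ → ℝ) (k : ℕ) : ℝ :=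
  ∑ S ∈ (Finset.Icc 1 n).powersetCard (n - k), ∏ i ∈ S, (-lam i)

/-- The composition `(φΔ - lam n I) ∘ ⋯ ∘ (φΔ - lam 1 I)`, where
`((φΔ - λ I) z) t = φ t · (z (t+1) - z t) - λ · z t`. -/
def compOpZ (φ : ℤ → ℝ) (lam : ℕ → ℝ) : ℕ → (ℤ → ℝ) → (ℤ → ℝ)
  | 0, y => y
  | (k+1), y => fun t =>
      φ t * (compOpZ φ lam k y (t + 1) - compOpZ φ lam k y t)
        - lam (k+1) * compOpZ φ lam k y t

/-- The operator `φΔ` as an endomorphism of the space of real sequences indexed by `ℤ`. -/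
def phiDelta (φ : ℤ → ℝ) : Module.End ℝ (ℤ → ℝ) where
  toFun y t := φ t * (y (t + 1) - y t)
  map_add' y z := by ext t; simp only [Pi.add_apply]; ring
  map_smul' c y := by ext t; simp only [Pi.smul_apply, smul_eq_mul, RingHom.id_apply]; ring

lemma phiDelta_apply (φ : ℤ → ℝ) (y : ℤ → ℝ) (t : ℤ) :
    phiDelta φ y t = φ t * (y (t + 1) - y t) := rfl

lemma phiDelta_pow_apply (φ : ℤ → ℝ) (k : ℕ) (y : ℤ → ℝ) :
    (phiDelta φ ^ k) y = Mz φ k y := by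
  induction k with
  | zero => rfl
  | succ k ih =>
    ext t
    rw [pow_succ', Module.End.mul_apply, ih, phiDelta_apply, Mz]

lemma aeval_phiDelta_prod_apply (φ : ℤ → ℝ) (lam : ℕ → ℝ) (n : ℕ) (y : ℤ → ℝ) :
    Polynomial.aeval (phiDelta φ)
      (∏ i ∈ Finset.Icc 1 n, (Polynomial.X + Polynomial.C (-lam i))) y = compOpZ φ lam n y := by
  induction n with
  | zero => simp [compOpZ]
  | succ n ih =>
    ext t
    rw [Finset.prod_Icc_succ_top (by omega), mul_comm, map_mul, Module.End.mul_apply, ih, compOpZ]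
    simp [phiDelta_apply, Module.algebraMap_end_apply, sub_eq_add_neg]

lemma alpha_eq_coeff (lam : ℕ → ℝ) {n k : ℕ} (hk : k ≤ n) :
    alpha n lam k =
      (∏ i ∈ Finset.Icc 1 n, (Polynomial.X + Polynomial.C (-lam i))).coeff k := by
  rw [Finset.prod_X_add_C_coeff _ _ (by simpa using hk), alpha, Nat.card_Icc,
    Nat.add_sub_cancel]

/-- Factorization of the n-th order Cauchy–Euler operator on the time scale ℤ. -/
theorem factorization_int (n : ℕ) (hn : 1 ≤ n) (lam : ℕ → ℝ) (φ : ℤ → ℝ) :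
    ∀ y : ℤ → ℝ, ∀ t : ℤ,
      ∑ k ∈ Finset.range (n + 1), alpha n lam k * Mz φ k y t = compOpZ φ lam n y t := by
  intro y t
  have hdeg : (∏ i ∈ Finset.Icc 1 n, (Polynomial.X + Polynomial.C (-lam i))).natDegree
      < n + 1 := by
    rw [Polynomial.natDegree_prod_of_monic _ _ fun i _ => Polynomial.monic_X_add_C _]
    simp only [Polynomial.natDegree_X_add_C]
    simp
  rw [← aeval_phiDelta_prod_apply, Polynomial.aeval_eq_sum_range' hdeg, LinearMap.sum_apply,
    Finset.sum_apply]
  refine Finset.sum_congr rfl fun k hk => ?_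
  rw [alpha_eq_coeff lam (Nat.lt_succ_iff.mp (Finset.mem_range.mp hk)), LinearMap.smul_apply,
    phiDelta_pow_apply, Pi.smul_apply, smul_eq_mul]
end

section
/- Let n ≥ 1, let a ≤ b be integers, let λ_1, …, λ_n be real numbers, let f : ℤ → ℝ, and let φ : ℤ → ℝ satisfy |φ(t)| ≥ A for all t ∈ {a, …, b+n−1}, for some constant A > 0, and φ(t) + λ_k ≠ 0 for all t ∈ {a, …, b+n−1} and all k = 1, …, n. Then there exists a constant K > 0 (depending only on n, a, b, A, φ, and λ_1, …, λ_n) such that for every ε > 0 and every x : ℤ → ℝ satisfying |∑_{k=0}^n α_k (M_k x)(t) − f(t)| ≤ ε for all t ∈ {a, …, b}, there exists u : ℤ → ℝ such that ∑_{k=0}^n α_k (M_k u)(t) = f(t) for all t ∈ {a, …, b} and |x(t) − u(t)| ≤ K ε for all t ∈ {a, …, b+n}. (This is the paper's main Hyers–Ulam stability theorem for the n-th order Cauchy–Euler dynamic equation, specialized to the time scale ℤ, where σ(t) = t+1 and μ(t) = 1.) -/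
/-- The operator `y ↦ φ · Δy` as a linear endomorphism of real sequences on `ℤ`. -/
def scaledDiff (φ : ℤ → ℝ) : Module.End ℝ (ℤ → ℝ) where
  toFun y t := φ t * (y (t + 1) - y t)
  map_add' y z := by
    ext t
    simp only [Pi.add_apply]
    ring
  map_smul' c y := by
    ext t
    simp only [Pi.smul_apply, smul_eq_mul, RingHom.id_apply]
    ring

lemma scaledDiff_apply (φ y : ℤ → ℝ) (t : ℤ) :
    scaledDiff φ y t = φ t * (y (t + 1) - y t) := rfl

lemma scaledDiff_pow_apply (φ y : ℤ → ℝ) (k : ℕ) : (scaledDiff φ ^ k) y = Mz φ k y := by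
  induction k with
  | zero => rfl
  | succ k ih =>
    rw [pow_succ', Module.End.mul_apply, ih]
    rfl

open Polynomial in
lemma sum_alpha_mul_X_pow (n : ℕ) (lam : ℕ → ℝ) :
    ∑ k ∈ Finset.range (n + 1), C (alpha n lam k) * X ^ k =
      ∏ i ∈ Finset.Icc 1 n, (X - C (lam i)) := by
  have h := Finset.prod_add (fun i => C (-lam i)) (fun _ => (X : ℝ[X])) (Finset.Icc 1 n)
  have hprod : ∏ i ∈ Finset.Icc 1 n, (X - C (lam i)) =
      ∏ i ∈ Finset.Icc 1 n, (C (-lam i) + X) :=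
    Finset.prod_congr rfl fun i _ => by rw [C_neg]; ring
  rw [hprod, h, Finset.sum_powerset, Nat.card_Icc, Nat.add_sub_cancel, ← Finset.sum_range_reflect]
  refine Finset.sum_congr rfl fun j hj => ?_
  have hj : j ≤ n := Nat.lt_succ_iff.mp (Finset.mem_range.mp hj)
  have hsub : n - (n + 1 - 1 - j) = j := by omega
  rw [alpha, hsub, map_sum, Finset.sum_mul]
  refine Finset.sum_congr rfl fun S hS => ?_
  obtain ⟨hS, hcard⟩ := Finset.mem_powersetCard.mp hS
  rw [map_prod, Finset.prod_const, Finset.card_sdiff_of_subset hS, Nat.card_Icc, hcard]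

open Polynomial in
lemma sum_alpha_mul_Mz_eq_aeval (n : ℕ) (lam : ℕ → ℝ) (φ y : ℤ → ℝ) (t : ℤ) :
    ∑ k ∈ Finset.range (n + 1), alpha n lam k * Mz φ k y t =
      aeval (scaledDiff φ) (∏ i ∈ Finset.Icc 1 n, (X - C (lam i))) y t := by
  simp [← sum_alpha_mul_X_pow, scaledDiff_pow_apply, LinearMap.sum_apply, Finset.sum_apply]

/-- Bounded solvability of the first-order equation `φ Δw - lam w = g`. -/
lemma exists_bounded_first_order_solution (a c : ℤ) (lam : ℝ) (φ : ℤ → ℝ) {A : ℝ} (hA : 0 < A)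
    (hφ : ∀ t ∈ Finset.Icc a c, A ≤ |φ t|) :
    ∃ K > 0, ∀ ε > 0, ∀ g : ℤ → ℝ, (∀ t ∈ Finset.Icc a c, |g t| ≤ ε) →
      ∃ w : ℤ → ℝ, (∀ t ∈ Finset.Icc a c, φ t * (w (t + 1) - w t) - lam * w t = g t) ∧
        ∀ t ∈ Finset.Icc a (c + 1), |w t| ≤ K * ε := by
  set r : ℝ := 1 + (|lam| + 1) / A with hr
  have hr1 : 1 ≤ r := le_add_of_nonneg_right (by positivity)
  refine ⟨r ^ (c + 1 - a).toNat, by positivity, fun ε hε g hg => ?_⟩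
  let v : ℕ → ℝ := fun m => Nat.rec 0 (fun j z => z + (lam * z + g (a + j)) / φ (a + j)) m
  have hv : ∀ m : ℕ, v (m + 1) = v m + (lam * v m + g (a + m)) / φ (a + m) := fun _ => rfl
  have hbound : ∀ m : ℕ, a + m ≤ c + 1 → |v m| + ε ≤ r ^ m * ε := by
    intro m
    induction m with
    | zero => intro _; simp [v]
    | succ m ih =>
      intro hm
      push_cast at hm
      have hmem : a + (m : ℤ) ∈ Finset.Icc a c := Finset.mem_Icc.mpr ⟨by omega, by omega⟩
      have hnum : |lam * v m + g (a + m)| ≤ (|lam| + 1) * (|v m| + ε) := by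
        have h1 := abs_add_le (lam * v m) (g (a + m))
        rw [abs_mul] at h1
        nlinarith [hg _ hmem, abs_nonneg lam, abs_nonneg (v m)]
      have hquot : |(lam * v m + g (a + m)) / φ (a + m)| ≤ (|lam| + 1) * (|v m| + ε) / A := by
        rw [abs_div]
        exact div_le_div₀ (by positivity) hnum hA (hφ _ hmem)
      calc |v (m + 1)| + ε
          ≤ |v m| + (|lam| + 1) * (|v m| + ε) / A + ε := by
            rw [hv]
            linarith [abs_add_le (v m) ((lam * v m + g (a + m)) / φ (a + m))]
        _ = r * (|v m| + ε) := by rw [hr]; ring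
        _ ≤ r * (r ^ m * ε) := mul_le_mul_of_nonneg_left (ih (by omega)) (by positivity)
        _ = r ^ (m + 1) * ε := by ring
  refine ⟨fun t => v (t - a).toNat, fun t ht => ?_, fun t ht => ?_⟩
  · have hφt : φ t ≠ 0 := abs_pos.mp (hA.trans_le (hφ t ht))
    obtain ⟨hat, -⟩ := Finset.mem_Icc.mp ht
    obtain ⟨m, rfl⟩ := Int.le.dest hat
    have h1 : (a + (m : ℤ) + 1 - a).toNat = m + 1 := by omega
    have h2 : (a + (m : ℤ) - a).toNat = m := by omega
    simp only [h1, h2, hv]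
    field_simp
    ring
  · obtain ⟨hat, htc⟩ := Finset.mem_Icc.mp ht
    have h := hbound (t - a).toNat (by omega)
    have hpow : r ^ (t - a).toNat ≤ r ^ (c + 1 - a).toNat := pow_le_pow_right₀ hr1 (by omega)
    have := mul_le_mul_of_nonneg_right hpow hε.le
    linarith

open Polynomial in
/-- Bounded solvability of the factored `n`-th order equation. -/
lemma exists_bounded_solution (a : ℤ) (lam : ℕ → ℝ) (φ : ℤ → ℝ) {A : ℝ} (hA : 0 < A) (n : ℕ) :
    ∀ c : ℤ, (∀ t ∈ Finset.Icc a (c + (n : ℤ) - 1), A ≤ |φ t|) →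
    ∃ K > 0, ∀ ε > 0, ∀ g : ℤ → ℝ, (∀ t ∈ Finset.Icc a c, |g t| ≤ ε) →
      ∃ w : ℤ → ℝ,
        (∀ t ∈ Finset.Icc a c,
          aeval (scaledDiff φ) (∏ i ∈ Finset.Icc 1 n, (X - C (lam i))) w t = g t) ∧
        ∀ t ∈ Finset.Icc a (c + (n : ℤ)), |w t| ≤ K * ε := by
  induction n with
  | zero => exact fun c _ => ⟨1, one_pos, fun ε _ g hg => ⟨g, by simp, by simpa using hg⟩⟩
  | succ n ih =>
    intro c hφ
    push_cast at hφ
    obtain ⟨K₁, hK₁, h₁⟩ := exists_bounded_first_order_solution a c (lam (n + 1)) φ hA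
      fun t ht => hφ t (Finset.Icc_subset_Icc_right (by omega) ht)
    obtain ⟨K₂, hK₂, h₂⟩ := ih (c + 1)
      fun t ht => hφ t (Finset.Icc_subset_Icc_right (by omega) ht)
    refine ⟨K₂ * K₁, by positivity, fun ε hε g hg => ?_⟩
    obtain ⟨v, hv, hvb⟩ := h₁ ε hε g hg
    obtain ⟨w, hw, hwb⟩ := h₂ (K₁ * ε) (by positivity) v hvb
    refine ⟨w, fun t ht => ?_, fun t ht => ?_⟩
    · obtain ⟨hat, htc⟩ := Finset.mem_Icc.mp ht
      rw [Finset.prod_Icc_succ_top (by omega), mul_comm, map_mul, Module.End.mul_apply, map_sub,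
        aeval_X, aeval_C, LinearMap.sub_apply, Pi.sub_apply, scaledDiff_apply,
        Module.algebraMap_end_apply, Pi.smul_apply, smul_eq_mul,
        hw t (Finset.mem_Icc.mpr ⟨hat, by omega⟩),
        hw (t + 1) (Finset.mem_Icc.mpr ⟨by omega, by omega⟩)]
      exact hv t ht
    · rw [mul_assoc]
      exact hwb t (Finset.Icc_subset_Icc_right (by push_cast; omega) ht)

/-- Hyers–Ulam stability of the n-th order Cauchy–Euler equation on the time scale ℤ. -/
theorem hyers_ulam_cauchy_euler_int (n : ℕ) (hn : 1 ≤ n) (a b : ℤ) (hab : a ≤ b)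
    (lam : ℕ → ℝ) (f φ : ℤ → ℝ)
    (A : ℝ) (hA : 0 < A)
    (hφ : ∀ t ∈ Finset.Icc a (b + (n : ℤ) - 1), A ≤ |φ t|)
    (hreg : ∀ t ∈ Finset.Icc a (b + (n : ℤ) - 1), ∀ k, 1 ≤ k → k ≤ n → φ t + lam k ≠ 0) :
    ∃ K > 0, ∀ ε > 0, ∀ x : ℤ → ℝ,
      (∀ t ∈ Finset.Icc a b,
          |∑ k ∈ Finset.range (n + 1), alpha n lam k * Mz φ k x t - f t| ≤ ε) →
      ∃ u : ℤ → ℝ,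
        (∀ t ∈ Finset.Icc a b,
            ∑ k ∈ Finset.range (n + 1), alpha n lam k * Mz φ k u t = f t) ∧
        (∀ t ∈ Finset.Icc a (b + (n : ℤ)), |x t - u t| ≤ K * ε) := by
  simp only [sum_alpha_mul_Mz_eq_aeval]
  obtain ⟨K, hK, h⟩ := exists_bounded_solution a lam φ hA n b hφ
  refine ⟨K, hK, fun ε hε x hx => ?_⟩
  obtain ⟨w, hw, hwb⟩ := h ε hε _ hx
  refine ⟨x - w, fun t ht => ?_, fun t ht => ?_⟩
  · rw [map_sub, Pi.sub_apply, hw t ht, sub_sub_cancel]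
  · simpa using hwb t ht
end

section
/- Let λ_1, λ_2 be real numbers, let 0 < a < b be reals, and let f : ℝ → ℝ be continuous on [a,b]. Then there exists a constant K > 0 (depending only on a, b, λ_1, λ_2) such that for every ε > 0 and every twice differentiable function y : ℝ → ℝ satisfying |y''(t) + ((1 − λ_1 − λ_2)/t)·y'(t) + (λ_1 λ_2 / t²)·y(t) − f(t)| ≤ ε for all t ∈ [a,b], there exists a twice differentiable function u : ℝ → ℝ with u''(t) + ((1 − λ_1 − λ_2)/t)·u'(t) + (λ_1 λ_2 / t²)·u(t) = f(t) for all t ∈ [a,b] and |y(t) − u(t)| ≤ K ε for all t ∈ [a,b]. (This is the second-order Cauchy–Euler stability theorem quoted as Theorem 1.1 of the paper, specialized to the time scale ℝ, where σ(t) = t and μ(t) = 0.) -/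
open Set in
/-- A function on `[a, b]` with derivative `G` extends to a global antiderivative of `G`. -/
theorem exists_antiderivative_eqOn_Icc {a b : ℝ} {V G : ℝ → ℝ} (hG : Continuous G)
    (hV : ∀ t ∈ Icc a b, HasDerivAt V (G t) t) :
    ∃ v : ℝ → ℝ, (∀ t, HasDerivAt v (G t) t) ∧ ∀ t ∈ Icc a b, v t = V t := by
  refine ⟨fun t => V a + ∫ s in a..t, G s, fun t => ?_, fun t ht => ?_⟩
  · exact (intervalIntegral.integral_hasDerivAt_right (hG.intervalIntegrable _ _)
      hG.stronglyMeasurable.stronglyMeasurableAtFilter hG.continuousAt).const_add _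
  · have h := intervalIntegral.integral_eq_sub_of_hasDerivAt (f := V) (f' := G) (a := a) (b := t)
      (fun s hs => by
        rw [uIcc_of_le ht.1] at hs
        exact hV s ⟨hs.1, hs.2.trans ht.2⟩) (hG.intervalIntegrable _ _)
    simp only [h]
    ring

open Set in
/-- Solvability of the initial value problem `t w' - lam w = h`, `w a = c` on `(0, ∞)`. -/
theorem exists_solution_first_order_cauchy_euler (lam c : ℝ) {a : ℝ} (ha : 0 < a) {h : ℝ → ℝ}
    (hh : ContinuousOn h (Ioi 0)) :
    ∃ w : ℝ → ℝ, w a = c ∧ ∀ t, 0 < t → HasDerivAt w ((lam * w t + h t) / t) t := by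
  set g : ℝ → ℝ := fun s => s ^ (-lam - 1) * h s with hg
  have hgc : ContinuousOn g (Ioi 0) := fun s hs =>
    ((Real.continuousAt_rpow_const s _ (Or.inl (ne_of_gt hs))).continuousWithinAt).mul (hh s hs)
  refine ⟨fun t => t ^ lam * (c * a ^ (-lam) + ∫ s in a..t, g s), ?_, fun t ht => ?_⟩
  · simp only [intervalIntegral.integral_same, add_zero]
    rw [Real.rpow_neg ha.le]
    field_simp
  · have hint : IntervalIntegrable g MeasureTheory.volume a t := by
      apply ContinuousOn.intervalIntegrable
      refine hgc.mono fun s hs => ?_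
      exact lt_of_lt_of_le (lt_min ha ht) hs.1
    have hI : HasDerivAt (fun t => ∫ s in a..t, g s) (g t) t :=
      intervalIntegral.integral_hasDerivAt_right hint
        (hgc.stronglyMeasurableAtFilter isOpen_Ioi t ht)
        (hgc.continuousAt (Ioi_mem_nhds ht))
    have hp := Real.hasDerivAt_rpow_const (p := lam) (Or.inl ht.ne')
    refine (hp.mul (hI.const_add (c * a ^ (-lam)))).congr_deriv ?_
    have h1 : t ^ (lam - 1) = t ^ lam / t := Real.rpow_sub_one ht.ne' _
    have h2 : t ^ (-lam - 1) = (t ^ lam)⁻¹ / t := by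
      rw [Real.rpow_sub_one ht.ne', Real.rpow_neg ht.le]
    have h3 : t ^ lam ≠ 0 := (Real.rpow_pos_of_pos ht _).ne'
    simp only [hg, h1, h2]
    field_simp

open Set in
/-- Stability of `t w' = lam w` on `[a, b]` under the initial condition `w a = 0`. -/
theorem exists_bound_first_order_cauchy_euler (lam : ℝ) {a b : ℝ} (ha : 0 < a) (hab : a < b) :
    ∃ K > 0, ∀ ε > 0, ∀ w w' : ℝ → ℝ, w a = 0 → (∀ t ∈ Icc a b, HasDerivAt w (w' t) t) →
      (∀ t ∈ Icc a b, |t * w' t - lam * w t| ≤ ε) → ∀ t ∈ Icc a b, |w t| ≤ K * ε := by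
  have hbd : ∀ p : ℝ, ∃ M > 0, ∀ t ∈ Icc a b, t ^ p ≤ M := by
    intro p
    obtain ⟨M, hM⟩ := isCompact_Icc.exists_bound_of_continuousOn
      (f := fun t : ℝ => t ^ p) (s := Icc a b) fun t ht =>
        (Real.continuousAt_rpow_const t p
          (Or.inl (ha.trans_le ht.1).ne')).continuousWithinAt
    have h : ∀ t ∈ Icc a b, t ^ p ≤ M := fun t ht => (le_abs_self _).trans (hM t ht)
    exact ⟨M, (Real.rpow_pos_of_pos ha p).trans_le (h a ⟨le_rfl, hab.le⟩), h⟩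
  obtain ⟨M, hM0, hM⟩ := hbd (-lam - 1)
  obtain ⟨N, hN0, hN⟩ := hbd lam
  refine ⟨N * (M * (b - a)), mul_pos hN0 (mul_pos hM0 (sub_pos.2 hab)), ?_⟩
  intro ε hε w w' hwa hw hle t ht
  have hder : ∀ s ∈ Icc a b, HasDerivWithinAt (fun s => s ^ (-lam) * w s)
      (s ^ (-lam - 1) * (s * w' s - lam * w s)) (Icc a b) s := by
    intro s hs
    have hs0 : 0 < s := ha.trans_le hs.1
    refine (((Real.hasDerivAt_rpow_const (p := -lam) (Or.inl hs0.ne')).mul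
      (hw s hs)).congr_deriv ?_).hasDerivWithinAt
    rw [Real.rpow_sub_one hs0.ne']
    field_simp
    ring
  have hmv := (convex_Icc a b).norm_image_sub_le_of_norm_hasDerivWithin_le (C := M * ε) hder
    (fun s hs => by
      have hs0 : 0 < s := ha.trans_le hs.1
      rw [Real.norm_eq_abs, abs_mul, abs_of_pos (Real.rpow_pos_of_pos hs0 _)]
      exact mul_le_mul (hM s hs) (hle s hs) (abs_nonneg _) hM0.le)
    (left_mem_Icc.2 hab.le) ht
  simp only [hwa, mul_zero, sub_zero, Real.norm_eq_abs] at hmv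
  have ht0 : 0 < t := ha.trans_le ht.1
  have hwt : w t = t ^ lam * (t ^ (-lam) * w t) := by
    have h3 : t ^ lam ≠ 0 := (Real.rpow_pos_of_pos ht0 _).ne'
    rw [Real.rpow_neg ht0.le]
    field_simp
  have hta : |t - a| ≤ b - a := by
    rw [abs_of_nonneg (sub_nonneg.2 ht.1)]
    linarith [ht.2]
  calc |w t| = t ^ lam * |t ^ (-lam) * w t| := by
        conv_lhs => rw [hwt]
        rw [abs_mul, abs_of_pos (Real.rpow_pos_of_pos ht0 lam)]
    _ ≤ N * (M * ε * (b - a)) := by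
        refine mul_le_mul (hN t ht) (hmv.trans ?_) (abs_nonneg _) hN0.le
        exact mul_le_mul_of_nonneg_left hta (by positivity)
    _ = N * (M * (b - a)) * ε := by ring

open Set in
/-- Solvability of the initial value problem for the second-order Cauchy–Euler equation on
`[a, b]`, by functions that are twice differentiable on the whole line. -/
theorem exists_solution_second_order_cauchy_euler (lam1 lam2 c d : ℝ) {a b : ℝ}
    (ha : 0 < a) (hab : a < b) {f : ℝ → ℝ} (hf : ContinuousOn f (Icc a b)) :
    ∃ u v g : ℝ → ℝ, u a = c ∧ v a = d ∧ (∀ t, HasDerivAt u (v t) t) ∧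
      (∀ t, HasDerivAt v (g t) t) ∧
      ∀ t ∈ Icc a b, g t + ((1 - lam1 - lam2) / t) * v t + (lam1 * lam2 / t ^ 2) * u t = f t := by
  set F : ℝ → ℝ := IccExtend hab.le ((Icc a b).domRestrict f) with hF
  have hFc : Continuous F := hf.domRestrict.Icc_extend'
  have hFf : ∀ t ∈ Icc a b, F t = f t := fun t ht => by
    simp [hF, IccExtend_of_mem hab.le _ ht]
  obtain ⟨w, hwa, hw⟩ := exists_solution_first_order_cauchy_euler lam1 (a * d - lam2 * c) ha
    (h := fun t => t ^ 2 * F t) (by fun_prop)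
  obtain ⟨U, hUa, hU⟩ := exists_solution_first_order_cauchy_euler lam2 c ha (h := w)
    fun t ht => (hw t ht).continuousAt.continuousWithinAt
  set V : ℝ → ℝ := fun t => (lam2 * U t + w t) / t with hVdef
  set G : ℝ → ℝ := fun t =>
    F t - (1 - lam1 - lam2) / t * V t - lam1 * lam2 / t ^ 2 * U t with hGdef
  have hV : ∀ t, 0 < t → HasDerivAt V (G t) t := by
    intro t ht
    refine ((((hU t ht).const_mul lam2).add (hw t ht)).div (hasDerivAt_id t)
      ht.ne').congr_deriv ?_
    simp only [hGdef, hVdef, id, Pi.add_apply]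
    field_simp
    ring
  have hGc : ContinuousOn G (Icc a b) := by
    intro t ht
    have ht0 : 0 < t := ha.trans_le ht.1
    have h1 := (hU t ht0).continuousAt
    have h2 := (hV t ht0).continuousAt
    have h3 : ContinuousAt G t :=
      (hFc.continuousAt.sub ((continuousAt_const.div continuousAt_id ht0.ne').mul h2)).sub
        ((continuousAt_const.div (continuousAt_id.pow 2) (pow_ne_zero 2 ht0.ne')).mul h1)
    exact h3.continuousWithinAt
  set g : ℝ → ℝ := IccExtend hab.le ((Icc a b).domRestrict G) with hg
  have hgG : ∀ t ∈ Icc a b, g t = G t := fun t ht => by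
    simp [hg, IccExtend_of_mem hab.le _ ht]
  obtain ⟨v, hv, hvV⟩ := exists_antiderivative_eqOn_Icc (a := a) (b := b) (V := V) (G := g)
    hGc.domRestrict.Icc_extend' fun t ht => by
      rw [hgG t ht]
      exact hV t (ha.trans_le ht.1)
  obtain ⟨u, hu, huU⟩ := exists_antiderivative_eqOn_Icc (a := a) (b := b) (V := U) (G := v)
    (continuous_iff_continuousAt.2 fun t => (hv t).continuousAt) fun t ht => by
      rw [hvV t ht]
      exact hU t (ha.trans_le ht.1)
  have hmem : a ∈ Icc a b := left_mem_Icc.2 hab.le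
  refine ⟨u, v, g, by rw [huU a hmem, hUa], ?_, hu, hv, fun t ht => ?_⟩
  · rw [hvV a hmem]
    simp only [hVdef, hUa, hwa]
    field_simp
    ring
  · rw [hgG t ht, hvV t ht, huU t ht, ← hFf t ht]
    simp only [hGdef]
    ring


/-- Hyers–Ulam stability of the second-order Cauchy–Euler equation
`y'' + ((1-λ₁-λ₂)/t) y' + (λ₁λ₂/t²) y = f` on the time scale ℝ. -/
theorem hyers_ulam_cauchy_euler_second_order_real (lam1 lam2 a b : ℝ)
    (ha : 0 < a) (hab : a < b) (f : ℝ → ℝ) (hf : ContinuousOn f (Set.Icc a b)) :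
    ∃ K > 0, ∀ ε > 0, ∀ y : ℝ → ℝ,
      Differentiable ℝ y → Differentiable ℝ (deriv y) →
      (∀ t ∈ Set.Icc a b,
          |deriv (deriv y) t + ((1 - lam1 - lam2) / t) * deriv y t
            + (lam1 * lam2 / t ^ 2) * y t - f t| ≤ ε) →
      ∃ u : ℝ → ℝ, Differentiable ℝ u ∧ Differentiable ℝ (deriv u) ∧
        (∀ t ∈ Set.Icc a b,
            deriv (deriv u) t + ((1 - lam1 - lam2) / t) * deriv u t
              + (lam1 * lam2 / t ^ 2) * u t = f t) ∧
        (∀ t ∈ Set.Icc a b, |y t - u t| ≤ K * ε) := by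
  obtain ⟨K₁, hK₁, hbound₁⟩ := exists_bound_first_order_cauchy_euler lam1 ha hab
  obtain ⟨K₂, hK₂, hbound₂⟩ := exists_bound_first_order_cauchy_euler lam2 ha hab
  have hb : 0 < b := ha.trans hab
  refine ⟨K₂ * (K₁ * b ^ 2), by positivity, fun ε hε y hy hy' hle => ?_⟩
  obtain ⟨u, v, g, hua, hva, hu, hv, heq⟩ :=
    exists_solution_second_order_cauchy_euler lam1 lam2 (y a) (deriv y a) ha hab hf
  have hdu : deriv u = v := funext fun t => (hu t).deriv
  have hdv : deriv v = g := funext fun t => (hv t).deriv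
  refine ⟨u, fun t => (hu t).differentiableAt, ?_, ?_, ?_⟩
  · rw [hdu]
    exact fun t => (hv t).differentiableAt
  · rw [hdu, hdv]
    exact heq
  have hz : ∀ t, HasDerivAt (fun t => y t - u t) (deriv y t - v t) t := fun t =>
    (hy t).hasDerivAt.sub (hu t)
  have hz' : ∀ t, HasDerivAt (fun t => deriv y t - v t) (deriv (deriv y) t - g t) t := fun t =>
    (hy' t).hasDerivAt.sub (hv t)
  have hw := hbound₁ (b ^ 2 * ε) (by positivity)
    (fun t => t * (deriv y t - v t) - lam2 * (y t - u t))
    (fun t => (1 * (deriv y t - v t) + t * (deriv (deriv y) t - g t))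
      - lam2 * (deriv y t - v t))
    (by simp [hua, hva])
    (fun t _ => ((hasDerivAt_id t).mul (hz' t)).sub ((hz t).const_mul lam2))
    (fun t ht => by
      have ht0 : 0 < t := ha.trans_le ht.1
      have hres : t * ((1 * (deriv y t - v t) + t * (deriv (deriv y) t - g t))
            - lam2 * (deriv y t - v t))
          - lam1 * (t * (deriv y t - v t) - lam2 * (y t - u t))
          = t ^ 2 * (deriv (deriv y) t + ((1 - lam1 - lam2) / t) * deriv y t
            + (lam1 * lam2 / t ^ 2) * y t - f t) := by
        rw [← heq t ht]
        field_simp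
        ring
      rw [hres, abs_mul, abs_of_pos (by positivity)]
      exact mul_le_mul (pow_le_pow_left₀ ht0.le ht.2 2) (hle t ht) (abs_nonneg _)
        (by positivity))
  intro t ht
  have h := hbound₂ (K₁ * (b ^ 2 * ε)) (by positivity) (fun t => y t - u t)
    (fun t => deriv y t - v t) (by simp [hua]) (fun t _ => hz t) hw t ht
  calc |y t - u t| ≤ K₂ * (K₁ * (b ^ 2 * ε)) := h
    _ = K₂ * (K₁ * b ^ 2) * ε := by ring
end

section
/- Let λ_1, λ_2 be real numbers, let a ≤ b be positive integers with t + λ_k ≠ 0 for all t ∈ {a, …, b+1} and k = 1, 2, and let f : ℤ → ℝ. Then there exists a constant K > 0 (depending only on a, b, λ_1, λ_2) such that for every ε > 0 and every y : ℤ → ℝ satisfying |Δ²y(t) + ((1 − λ_1 − λ_2)/(t+1))·Δy(t) + (λ_1 λ_2 / (t(t+1)))·y(t) − f(t)| ≤ ε for all t ∈ {a, …, b}, there exists u : ℤ → ℝ with Δ²u(t) + ((1 − λ_1 − λ_2)/(t+1))·Δu(t) + (λ_1 λ_2 / (t(t+1)))·u(t) = f(t) for all t ∈ {a, …, b} and |y(t)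 − u(t)| ≤ K ε for all t ∈ {a, …, b+2}. (This is the second-order Cauchy–Euler stability theorem quoted as Theorem 1.1 of the paper, specialized to the time scale ℤ, where σ(t) = t+1 and μ(t) = 1.) -/
theorem exists_second_order_recurrence {α : Type*} (g : ℕ → α → α → α) (x₀ x₁ : α) :
    ∃ v : ℕ → α, v 0 = x₀ ∧ v 1 = x₁ ∧ ∀ n, v (n + 2) = g n (v n) (v (n + 1)) :=
  let w : ℕ → α × α := fun n => Nat.rec (x₀, x₁) (fun k z => (z.2, g k z.1 z.2)) n
  ⟨fun n => (w n).1, rfl, rfl, fun _ => rfl⟩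

/-- On a finite range, the solution of a second-order linear recurrence with zero initial values is
bounded by a constant multiple of the forcing term. -/
theorem exists_bound_linear_recurrence (p q : ℕ → ℝ) (N : ℕ) :
    ∃ K > 0, ∀ (r : ℕ → ℝ) (ε : ℝ), 0 < ε → (∀ n ≤ N, |r n| ≤ ε) →
      ∃ d : ℕ → ℝ, (∀ n, d (n + 2) + p n * d (n + 1) + q n * d n = r n) ∧
        ∀ n ≤ N + 2, |d n| ≤ K * ε := by
  obtain ⟨C, hC₀, hC₁, hC⟩ :=
    exists_second_order_recurrence (fun n x y => 1 + |p n| * y + |q n| * x) (0 : ℝ) 0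
  have hC_nonneg : ∀ n, 0 ≤ C n := by
    intro n
    induction n using Nat.twoStepInduction with
    | zero => exact hC₀.ge
    | one => exact hC₁.ge
    | more n h₀ h₁ => rw [hC]; positivity
  have hsum : 0 ≤ ∑ n ∈ Finset.range (N + 3), C n := Finset.sum_nonneg fun n _ => hC_nonneg n
  refine ⟨1 + ∑ n ∈ Finset.range (N + 3), C n, by positivity, fun r ε hε hr => ?_⟩
  obtain ⟨d, hd₀, hd₁, hd⟩ :=
    exists_second_order_recurrence (fun n x y => r n - p n * y - q n * x) (0 : ℝ) 0
  have hbound : ∀ n ≤ N + 2, |d n| ≤ C n * ε := by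
    intro n
    induction n using Nat.twoStepInduction with
    | zero => simp [hd₀, hC₀]
    | one => simp [hd₁, hC₁]
    | more n h₀ h₁ =>
      intro hn
      rw [hd, hC]
      calc |r n - p n * d (n + 1) - q n * d n|
          ≤ |r n| + |p n| * |d (n + 1)| + |q n| * |d n| := by
            rw [← abs_mul, ← abs_mul]
            exact (abs_sub _ _).trans (by gcongr; exact abs_sub _ _)
        _ ≤ ε + |p n| * (C (n + 1) * ε) + |q n| * (C n * ε) := by
            gcongr
            · exact hr n (by omega)
            · exact h₁ (by omega)
            · exact h₀ (by omega)
        _ = (1 + |p n| * C (n + 1) + |q n| * C n) * ε := by ring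
  refine ⟨d, fun n => by rw [hd]; ring, fun n hn => (hbound n hn).trans ?_⟩
  gcongr
  have := Finset.single_le_sum (fun n _ => hC_nonneg n) (Finset.mem_range.mpr (by omega : n < N + 3))
  linarith

/-- Hyers–Ulam stability of the second-order Cauchy–Euler difference equation
`Δ²y(t) + ((1-λ₁-λ₂)/(t+1)) Δy(t) + (λ₁λ₂/(t(t+1))) y(t) = f(t)`
on the time scale ℤ (where `Δy t = y (t+1) - y t`). -/
theorem hyers_ulam_cauchy_euler_second_order_int (lam1 lam2 : ℝ) (a b : ℤ)
    (ha : 0 < a) (hab : a ≤ b)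
    (hreg : ∀ t ∈ Finset.Icc a (b + 1), (t : ℝ) + lam1 ≠ 0 ∧ (t : ℝ) + lam2 ≠ 0)
    (f : ℤ → ℝ) :
    ∃ K > 0, ∀ ε > 0, ∀ y : ℤ → ℝ,
      (∀ t ∈ Finset.Icc a b,
          |(y (t + 2) - 2 * y (t + 1) + y t)
            + ((1 - lam1 - lam2) / ((t : ℝ) + 1)) * (y (t + 1) - y t)
            + (lam1 * lam2 / ((t : ℝ) * ((t : ℝ) + 1))) * y t - f t| ≤ ε) →
      ∃ u : ℤ → ℝ,
        (∀ t ∈ Finset.Icc a b,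
            (u (t + 2) - 2 * u (t + 1) + u t)
              + ((1 - lam1 - lam2) / ((t : ℝ) + 1)) * (u (t + 1) - u t)
              + (lam1 * lam2 / ((t : ℝ) * ((t : ℝ) + 1))) * u t = f t) ∧
        (∀ t ∈ Finset.Icc a (b + 2), |y t - u t| ≤ K * ε) := by
  let A : ℤ → ℝ := fun t => (1 - lam1 - lam2) / ((t : ℝ) + 1)
  let B : ℤ → ℝ := fun t => lam1 * lam2 / ((t : ℝ) * ((t : ℝ) + 1))
  obtain ⟨K, hK, hbound⟩ := exists_bound_linear_recurrence
    (fun n => A (a + n) - 2) (fun n => 1 - A (a + n) + B (a + n)) (b - a).toNat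
  refine ⟨K, hK, fun ε hε y hy => ?_⟩
  obtain ⟨d, hd, hdK⟩ := hbound
    (fun n => (y (a + n + 2) - 2 * y (a + n + 1) + y (a + n))
      + A (a + n) * (y (a + n + 1) - y (a + n)) + B (a + n) * y (a + n) - f (a + n)) ε hε
    (fun n hn => hy (a + n) (Finset.mem_Icc.mpr (by omega)))
  refine ⟨fun t => y t - d (t - a).toNat, fun t ht => ?_, fun t ht => ?_⟩
  · rw [Finset.mem_Icc] at ht
    obtain ⟨n, rfl⟩ := Int.le.dest ht.1
    have h₀ : (a + n - a).toNat = n := by omega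
    have h₁ : (a + n + 1 - a).toNat = n + 1 := by omega
    have h₂ : (a + n + 2 - a).toNat = n + 2 := by omega
    have h := hd n
    simp only [h₀, h₁, h₂]
    change _ + A (a + n) * _ + B (a + n) * _ = _
    linarith
  · rw [Finset.mem_Icc] at ht
    simpa using hdK (t - a).toNat (by omega)
end

section
/- Let n ≥ 1, let a < b be reals, let λ_1, …, λ_n be real numbers, let φ, f : ℝ → ℝ, and let w_0, w_1, …, w_n : ℝ → ℝ with w_0 = f, such that for each k = 1, …, n the function w_k is differentiable on [a,b] and φ(t)·w_k'(t) − λ_{n−k+1}·w_k(t) = w_{k−1}(t) for all t ∈ [a,b]. If additionally M_j w_n is differentiable on [a,b] for each j = 0, …, n−1, then u = w_n satisfies ∑_{k=0}^n α_k (M_k u)(t) = f(t) for all t ∈ [a,b]. (This is the verification step in the paper's stability proof: a cascade of solutions of first-order equations yields an exact solution of the n-th order Cauchy–Euler equation; specialized to the time scale ℝ.) -/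
/-- The Cauchy–Euler operators on the time scale ℝ:
`M 0 y = y`, `M (k+1) y = φ · (M k y)'`. -/
noncomputable def M (φ : ℝ → ℝ) : ℕ → (ℝ → ℝ) → (ℝ → ℝ)
  | 0, y => y
  | (k+1), y => fun t => φ t * deriv (M φ k y) t

theorem alpha_self (n : ℕ) (lam : ℕ → ℝ) : alpha n lam n = 1 := by
  simp [alpha]

theorem sum_powersetCard_Icc_succ (m j : ℕ) (g : ℕ → ℝ) :
    ∑ S ∈ (Finset.Icc 1 (m + 1)).powersetCard (j + 1), ∏ i ∈ S, g i =
      ∑ S ∈ (Finset.Icc 1 m).powersetCard (j + 1), ∏ i ∈ S, g i +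
        g (m + 1) * ∑ S ∈ (Finset.Icc 1 m).powersetCard j, ∏ i ∈ S, g i := by
  have hIcc : Finset.Icc 1 (m + 1) = insert (m + 1) (Finset.Icc 1 m) := by
    ext i
    simp only [Finset.mem_Icc, Finset.mem_insert]
    omega
  have hm : m + 1 ∉ Finset.Icc 1 m := by simp
  have hmem : ∀ S ∈ (Finset.Icc 1 m).powersetCard j, m + 1 ∉ S := fun S hS h =>
    hm ((Finset.mem_powersetCard.1 hS).1 h)
  rw [hIcc, Finset.powersetCard_succ_insert hm, Finset.sum_union, Finset.sum_image,
    Finset.mul_sum]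
  · congr 1
    exact Finset.sum_congr rfl fun S hS => Finset.prod_insert (hmem S hS)
  · intro S hS T hT h
    rw [← Finset.erase_insert (hmem S hS), ← Finset.erase_insert (hmem T hT), h]
  · rw [Finset.disjoint_left]
    intro S hS hS'
    obtain ⟨T, -, rfl⟩ := Finset.mem_image.1 hS'
    exact hm ((Finset.mem_powersetCard.1 hS).1 (Finset.mem_insert_self _ _))

theorem alpha_succ_succ {m k : ℕ} (hk : k < m) (lam : ℕ → ℝ) :
    alpha (m + 1) lam (k + 1) = alpha m lam k - lam (m + 1) * alpha m lam (k + 1) := by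
  obtain ⟨j, rfl⟩ := Nat.exists_eq_add_of_lt hk
  have h₁ : k + j + 1 + 1 - (k + 1) = j + 1 := by omega
  have h₂ : k + j + 1 - k = j + 1 := by omega
  have h₃ : k + j + 1 - (k + 1) = j := by omega
  simp only [alpha, h₁, h₂, h₃]
  rw [sum_powersetCard_Icc_succ]
  ring

theorem alpha_succ_zero (m : ℕ) (lam : ℕ → ℝ) :
    alpha (m + 1) lam 0 = -lam (m + 1) * alpha m lam 0 := by
  simp only [alpha, Nat.sub_zero]
  rw [sum_powersetCard_Icc_succ, Finset.powersetCard_eq_empty.2 (by simp)]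
  simp

/-- The recursion of the coefficients `alpha`, summed against an arbitrary sequence. -/
theorem sum_alpha_succ_mul (m : ℕ) (lam x : ℕ → ℝ) :
    ∑ k ∈ Finset.range (m + 2), alpha (m + 1) lam k * x k =
      ∑ k ∈ Finset.range (m + 1), alpha m lam k * x (k + 1) -
        lam (m + 1) * ∑ k ∈ Finset.range (m + 1), alpha m lam k * x k := by
  rw [Finset.sum_range_succ', Finset.sum_range_succ, alpha_self, alpha_succ_zero,
    Finset.sum_range_succ (fun k => alpha m lam k * x (k + 1)), alpha_self,
    Finset.sum_range_succ' (fun k => alpha m lam k * x k),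
    Finset.sum_congr rfl fun k hk => by rw [alpha_succ_succ (Finset.mem_range.1 hk)]]
  simp only [sub_mul, Finset.sum_sub_distrib, mul_add, Finset.mul_sum, mul_assoc]
  ring

theorem deriv_eq_of_eqOn_Icc {a b : ℝ} (hab : a < b) {g h : ℝ → ℝ}
    (hgh : Set.EqOn g h (Set.Icc a b)) {t : ℝ} (ht : t ∈ Set.Icc a b)
    (hg : DifferentiableAt ℝ g t) (hh : DifferentiableAt ℝ h t) : deriv g t = deriv h t := by
  have hu := uniqueDiffOn_Icc hab t ht
  rw [← hg.derivWithin hu, ← hh.derivWithin hu]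
  exact derivWithin_congr hgh (hgh ht)

/-- A cascade of solutions of first-order equations yields an exact solution of the
n-th order Cauchy–Euler equation (time scale ℝ). -/
theorem cascade_solves_real (n : ℕ) (hn : 1 ≤ n) (a b : ℝ) (hab : a < b)
    (lam : ℕ → ℝ) (φ f : ℝ → ℝ) (w : ℕ → ℝ → ℝ) (hw0 : w 0 = f)
    (hwdiff : ∀ k, 1 ≤ k → k ≤ n → ∀ t ∈ Set.Icc a b, DifferentiableAt ℝ (w k) t)
    (hcascade : ∀ k, 1 ≤ k → k ≤ n → ∀ t ∈ Set.Icc a b,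
        φ t * deriv (w k) t - lam (n - k + 1) * w k t = w (k - 1) t)
    (hM : ∀ j < n, ∀ t ∈ Set.Icc a b, DifferentiableAt ℝ (M φ j (w n)) t) :
    ∀ t ∈ Set.Icc a b,
      ∑ k ∈ Finset.range (n + 1), alpha n lam k * M φ k (w n) t = f t := by
  suffices h : ∀ m ≤ n, ∀ t ∈ Set.Icc a b,
      w (n - m) t = ∑ k ∈ Finset.range (m + 1), alpha m lam k * M φ k (w n) t by
    intro t ht
    rw [← h n le_rfl t ht, Nat.sub_self, hw0]
  intro m
  induction m with
  | zero =>
    intro _ t _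
    simp [alpha_self, M]
  | succ m ih =>
    intro hm t ht
    have ih := ih (by omega)
    have hd : ∀ k ∈ Finset.range (m + 1),
        DifferentiableAt ℝ (fun s => alpha m lam k * M φ k (w n) s) t := fun k hk =>
      (hM k (by have := Finset.mem_range.1 hk; omega) t ht).const_mul _
    have hderiv : deriv (w (n - m)) t =
        ∑ k ∈ Finset.range (m + 1), alpha m lam k * deriv (M φ k (w n)) t := by
      rw [deriv_eq_of_eqOn_Icc hab ih ht (hwdiff _ (by omega) (by omega) t ht)
        (DifferentiableAt.fun_sum hd), deriv_fun_sum hd]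
      simp only [deriv_const_mul_field]
    have hc := hcascade (n - m) (by omega) (by omega) t ht
    rw [show n - (n - m) + 1 = m + 1 by omega, show n - m - 1 = n - (m + 1) by omega] at hc
    rw [← hc, sum_alpha_succ_mul m lam fun k => M φ k (w n) t, hderiv, ih t ht, Finset.mul_sum]
    congr 1
    refine Finset.sum_congr rfl fun k _ => ?_
    simp only [M]
    ring
end

section
/- Let a < b be reals, let p, g : ℝ → ℝ be continuous on [a,b], let ε > 0, and let x : ℝ → ℝ be differentiable on [a,b] with |x'(t) − p(t)·x(t) − g(t)| ≤ ε for all t ∈ [a,b]. Define u(t) = exp(∫_a^t p(r) dr)·x(a) + ∫_a^t exp(∫_s^t p(r) dr)·g(s) ds. Then u is differentiable on [a,b], u'(t) = p(t)·u(t) + g(t) for all t ∈ [a,b], and |x(t) − u(t)| ≤ ε·(b − a)·exp((b − a)·sup_{s∈[a,b]} |p(s)|) for all t ∈ [a,b]. (This is the first-order Hyers–Ulam stability lemma, with explicit constant, underlying each iterative step of the paper's stability proof; specialized to the time scale ℝ.) -/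
open intervalIntegral

/-- The primitive of a function continuous on `[a, b]` has that function as its derivative
within `[a, b]`. -/
theorem ContinuousOn.hasDerivWithinAt_primitive {a b : ℝ} {f : ℝ → ℝ}
    (hf : ContinuousOn f (Set.Icc a b)) {t : ℝ} (ht : t ∈ Set.Icc a b) :
    HasDerivWithinAt (fun u => ∫ r in a..u, f r) (f t) (Set.Icc a b) t := by
  have : Fact (t ∈ Set.Icc a b) := ⟨ht⟩
  refine integral_hasDerivWithinAt_right (t := Set.Icc a b) ?_ ?_ (hf t ht)
  · exact (hf.mono (Set.Icc_subset_Icc_right ht.2)).intervalIntegrable_of_Icc ht.1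
  · exact hf.stronglyMeasurableAtFilter_nhdsWithin measurableSet_Icc t

/-- First-order Hyers–Ulam stability lemma with explicit constant, time scale ℝ. -/
theorem first_order_hyers_ulam_real (a b : ℝ) (hab : a < b) (p g : ℝ → ℝ)
    (hp : ContinuousOn p (Set.Icc a b)) (hg : ContinuousOn g (Set.Icc a b))
    (ε : ℝ) (hε : 0 < ε) (x : ℝ → ℝ)
    (hxdiff : ∀ t ∈ Set.Icc a b, DifferentiableAt ℝ x t)
    (hx : ∀ t ∈ Set.Icc a b, |deriv x t - p t * x t - g t| ≤ ε)
    (u : ℝ → ℝ)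
    (hu : ∀ t, u t = Real.exp (∫ r in a..t, p r) * x a
        + ∫ s in a..t, Real.exp (∫ r in s..t, p r) * g s) :
    (∀ t ∈ Set.Icc a b, HasDerivWithinAt u (p t * u t + g t) (Set.Icc a b) t) ∧
      ∀ t ∈ Set.Icc a b,
        |x t - u t| ≤ ε * (b - a) *
          Real.exp ((b - a) * sSup ((fun s => |p s|) '' Set.Icc a b)) := by
  set P : ℝ → ℝ := fun t => ∫ r in a..t, p r with hPdef
  have hP : ∀ t ∈ Set.Icc a b, HasDerivWithinAt P (p t) (Set.Icc a b) t :=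
    fun t ht => hp.hasDerivWithinAt_primitive ht
  have hPc : ContinuousOn P (Set.Icc a b) := fun t ht => (hP t ht).continuousWithinAt
  have hpi : ∀ t ∈ Set.Icc a b, IntervalIntegrable p MeasureTheory.volume a t := fun t ht =>
    (hp.mono (Set.Icc_subset_Icc_right ht.2)).intervalIntegrable_of_Icc ht.1
  have hsub : ∀ s ∈ Set.Icc a b, ∀ t ∈ Set.Icc a b, ∫ r in s..t, p r = P t - P s :=
    fun s hs t ht => (integral_interval_sub_left (hpi t ht) (hpi s hs)).symm
  set G : ℝ → ℝ := fun t => ∫ s in a..t, Real.exp (-P s) * g s with hGdef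
  have hG : ∀ t ∈ Set.Icc a b,
      HasDerivWithinAt G (Real.exp (-P t) * g t) (Set.Icc a b) t := fun t ht =>
    ContinuousOn.hasDerivWithinAt_primitive (f := fun s => Real.exp (-P s) * g s)
      (hPc.neg.rexp.mul hg) ht
  have hu' : ∀ t ∈ Set.Icc a b, u t = Real.exp (P t) * (x a + G t) := by
    intro t ht
    rw [hu, mul_add, hGdef]
    simp only
    rw [← integral_const_mul]
    congr 1
    refine integral_congr fun s hs => ?_
    rw [Set.uIcc_of_le ht.1] at hs
    rw [hsub s ⟨hs.1, hs.2.trans ht.2⟩ t ht, sub_eq_add_neg, Real.exp_add, mul_assoc]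
  have hderiv : ∀ t ∈ Set.Icc a b,
      HasDerivWithinAt u (p t * u t + g t) (Set.Icc a b) t := by
    intro t ht
    refine (((hP t ht).exp.mul ((hG t ht).const_add (x a))).congr_deriv ?_).congr hu' (hu' t ht)
    have h : Real.exp (P t) * Real.exp (-P t) = 1 := by rw [← Real.exp_add]; simp
    rw [hu' t ht]
    linear_combination g t * h
  refine ⟨hderiv, fun t ht => ?_⟩
  set M := sSup ((fun s => |p s|) '' Set.Icc a b) with hM
  have hpM : ∀ s ∈ Set.Icc a b, |p s| ≤ M := fun s hs =>
    le_csSup (isCompact_Icc.bddAbove_image hp.abs) (Set.mem_image_of_mem _ hs)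
  have ha : a ∈ Set.Icc a b := ⟨le_rfl, hab.le⟩
  have hM0 : 0 ≤ M := (abs_nonneg _).trans (hpM a ha)
  have hst : Set.Icc a t ⊆ Set.Icc a b := Set.Icc_subset_Icc_right ht.2
  have hPM : ∀ s ∈ Set.Icc a t, P t - P s ≤ (b - a) * M := by
    intro s hs
    have h := (convex_Icc a b).norm_image_sub_le_of_norm_hasDerivWithin_le hP hpM (hst hs) ht
    rw [Real.norm_eq_abs, Real.norm_eq_abs, abs_of_nonneg (sub_nonneg.2 hs.2)] at h
    have : M * (t - s) ≤ M * (b - a) :=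
      mul_le_mul_of_nonneg_left (by linarith [hs.1, ht.2]) hM0
    linarith [le_abs_self (P t - P s)]
  have hw : ∀ s ∈ Set.Icc a t, HasDerivWithinAt (fun s => Real.exp (P t - P s) * (x s - u s))
      (Real.exp (P t - P s) * (deriv x s - p s * x s - g s)) (Set.Icc a t) s := by
    intro s hs
    have h := (((hP s (hst hs)).const_sub (P t)).exp.mul
      ((hxdiff s (hst hs)).hasDerivAt.hasDerivWithinAt.sub (hderiv s (hst hs)))).mono hst
    refine h.congr_deriv ?_
    simp only [Pi.sub_apply]
    ring
  have hua : u a = x a := by simp [hu a]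
  have key := norm_image_sub_le_of_norm_deriv_le_segment' (C := Real.exp ((b - a) * M) * ε) hw
    (fun s hs => by
      have hs' := Set.Ico_subset_Icc_self hs
      rw [norm_mul, Real.norm_eq_abs, Real.abs_exp, Real.norm_eq_abs]
      exact mul_le_mul (Real.exp_le_exp.2 (hPM s hs')) (hx s (hst hs')) (abs_nonneg _)
        (Real.exp_pos _).le) t ⟨ht.1, le_rfl⟩
  simp only [hua, sub_self, Real.exp_zero, one_mul, mul_zero, sub_zero, Real.norm_eq_abs] at key
  calc |x t - u t| ≤ Real.exp ((b - a) * M) * ε * (t - a) := key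
    _ ≤ Real.exp ((b - a) * M) * ε * (b - a) :=
        mul_le_mul_of_nonneg_left (by linarith [ht.2]) (by positivity)
    _ = ε * (b - a) * Real.exp ((b - a) * M) := by ring
end

section
/- Let a ≤ b be integers, let p, g : ℤ → ℝ with 1 + p(t) ≠ 0 for all t ∈ {a, …, b}, let ε > 0, and let x : ℤ → ℝ satisfy |x(t+1) − x(t) − p(t)·x(t) − g(t)| ≤ ε for all t ∈ {a, …, b}. Define u : {a, …, b+1} → ℝ recursively by u(a) = x(a) and u(t+1) = (1 + p(t))·u(t) + g(t) for t ∈ {a, …, b}. Then u(t+1) − u(t) = p(t)·u(t) + g(t) for all t ∈ {a, …, b}, and |x(t) − u(t)| ≤ ε · ∑_{s=a}^{t−1} ∏_{r=s+1}^{t−1} |1 + p(r)| for all t ∈ {a, …, b+1} (empty sums equal 0 and empty products equal 1). (This is the first-order Hyers–Ulam stability lemma, with explicit constant, underlying each iterative step of the paper's stability proof; specialized to the time scale ℤ.) -/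
theorem Int.Ico_add_one_right_eq_insert {a t : ℤ} (h : a ≤ t) :
    Finset.Ico a (t + 1) = insert t (Finset.Ico a t) := by
  ext s
  simp only [Finset.mem_Ico, Finset.mem_insert]
  omega

theorem Int.sum_prod_Ico_add_one {R : Type*} [CommSemiring R] (q : ℤ → R) {a t : ℤ} (h : a ≤ t) :
    ∑ s ∈ Finset.Ico a (t + 1), ∏ r ∈ Finset.Ico (s + 1) (t + 1), q r =
      q t * ∑ s ∈ Finset.Ico a t, ∏ r ∈ Finset.Ico (s + 1) t, q r + 1 := by
  rw [Int.Ico_add_one_right_eq_insert h, Finset.sum_insert (by simp), Finset.Ico_self,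
    Finset.prod_empty, add_comm, Finset.mul_sum]
  congr 1
  refine Finset.sum_congr rfl fun s hs => ?_
  rw [Int.Ico_add_one_right_eq_insert (by have := (Finset.mem_Ico.mp hs).2; omega),
    Finset.prod_insert (by simp)]


/-- First-order Hyers–Ulam stability lemma with explicit constant, time scale ℤ. -/
theorem first_order_hyers_ulam_int (a b : ℤ) (hab : a ≤ b) (p g : ℤ → ℝ)
    (hreg : ∀ t ∈ Finset.Icc a b, 1 + p t ≠ 0)
    (ε : ℝ) (hε : 0 < ε) (x : ℤ → ℝ)
    (hx : ∀ t ∈ Finset.Icc a b, |x (t + 1) - x t - p t * x t - g t| ≤ ε)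
    (u : ℤ → ℝ) (hua : u a = x a)
    (hurec : ∀ t ∈ Finset.Icc a b, u (t + 1) = (1 + p t) * u t + g t) :
    (∀ t ∈ Finset.Icc a b, u (t + 1) - u t = p t * u t + g t) ∧
      ∀ t ∈ Finset.Icc a (b + 1),
        |x t - u t| ≤ ε * ∑ s ∈ Finset.Ico a t, ∏ r ∈ Finset.Ico (s + 1) t, |1 + p r| := by
  refine ⟨fun t ht => by rw [hurec t ht]; ring, fun t ht => ?_⟩
  obtain ⟨hat, htb⟩ := Finset.mem_Icc.mp ht
  clear ht
  induction t, hat using Int.leInduction with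
  | base => simp [hua]
  | succ t hat ih =>
    have ht : t ∈ Finset.Icc a b := Finset.mem_Icc.mpr ⟨hat, by omega⟩
    rw [Int.sum_prod_Ico_add_one (fun r => |1 + p r|) hat]
    have hsplit : x (t + 1) - u (t + 1) =
        (1 + p t) * (x t - u t) + (x (t + 1) - x t - p t * x t - g t) := by
      rw [hurec t ht]; ring
    calc |x (t + 1) - u (t + 1)|
        ≤ |1 + p t| * |x t - u t| + |x (t + 1) - x t - p t * x t - g t| := by
          rw [hsplit, ← abs_mul]; exact abs_add_le _ _
      _ ≤ |1 + p t| * (ε * ∑ s ∈ Finset.Ico a t, ∏ r ∈ Finset.Ico (s + 1) t, |1 + p r|) + ε := by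
          gcongr
          · exact ih (by omega)
          · exact hx t ht
      _ = _ := by ring
end

section
/- Let a < b be reals, let λ ∈ ℝ, let f : ℝ → ℝ be continuous on [a,b], and let φ : ℝ → ℝ be continuous on [a,b] with |φ(t)| ≥ A for all t ∈ [a,b], for some constant A > 0. Then there exists a constant K > 0 (depending only on a, b, A, φ, λ) such that for every ε > 0 and every differentiable x : ℝ → ℝ with |φ(t)·x'(t) − λ·x(t) − f(t)| ≤ ε for all t ∈ [a,b], there exists a differentiable u : ℝ → ℝ with φ(t)·u'(t) − λ·u(t) = f(t) for all t ∈ [a,b] and |x(t) − u(t)| ≤ K ε for all t ∈ [a,b]. (This is the n = 1 case of the paper's main Hyers–Ulam stability theorem, specialized to the time scale ℝ.) -/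
/-- The first-order linear equation `y' = p y + q` with continuous coefficients has a solution
with prescribed value at `a`. -/
theorem exists_hasDerivAt_linear {p q : ℝ → ℝ} (hp : Continuous p) (hq : Continuous q) (a c : ℝ) :
    ∃ u : ℝ → ℝ, u a = c ∧ ∀ t, HasDerivAt u (p t * u t + q t) t := by
  set P : ℝ → ℝ := fun t => ∫ s in a..t, p s with hP
  have hPd (t : ℝ) : HasDerivAt P (p t) t := hp.integral_hasStrictDerivAt a t |>.hasDerivAt
  have hPc : Continuous P := continuous_iff_continuousAt.2 fun t => (hPd t).continuousAt
  have hg : Continuous fun s => Real.exp (-P s) * q s := by fun_prop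
  refine ⟨fun t => Real.exp (P t) * (c + ∫ s in a..t, Real.exp (-P s) * q s), by simp [hP],
    fun t => ?_⟩
  have h : Real.exp (P t) * Real.exp (-P t) = 1 := by simp [← Real.exp_add]
  refine ((hPd t).exp.mul
    ((hg.integral_hasStrictDerivAt a t).hasDerivAt.const_add c)).congr_deriv ?_
  linear_combination q t * h

/-- A function vanishing at `a` with `|w'| ≤ k |w| + δ` is bounded on `[a, b]` by a multiple
of `δ`. -/
theorem abs_le_of_abs_deriv_le {a b k δ : ℝ} (hk : 0 < k) (hδ : 0 ≤ δ) {w w' : ℝ → ℝ}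
    (hw : ∀ t ∈ Set.Icc a b, HasDerivAt w (w' t) t) (ha : w a = 0)
    (hbound : ∀ t ∈ Set.Icc a b, |w' t| ≤ k * |w t| + δ) {t : ℝ} (ht : t ∈ Set.Icc a b) :
    |w t| ≤ δ / k * Real.exp (k * (b - a)) := by
  have h := norm_le_gronwallBound_of_norm_deriv_right_le (δ := 0) (K := k) (ε := δ)
    (fun s hs => (hw s hs).continuousAt.continuousWithinAt)
    (fun s hs => (hw s (Set.Ico_subset_Icc_self hs)).hasDerivWithinAt) (by simp [ha])
    (fun s hs => hbound s (Set.Ico_subset_Icc_self hs)) t ht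
  simp only [gronwallBound_of_K_ne_0 hk.ne', zero_mul, zero_add, Real.norm_eq_abs] at h
  refine h.trans (mul_le_mul_of_nonneg_left ?_ (by positivity))
  have : Real.exp (k * (t - a)) ≤ Real.exp (k * (b - a)) := by
    gcongr
    exact ht.2
  linarith


/-- Hyers–Ulam stability of the first-order equation `φ x' - λ x = f` on `[a,b]`
(the n = 1 case of the main theorem, time scale ℝ). -/
theorem hyers_ulam_first_order_real (a b : ℝ) (hab : a < b) (lam : ℝ)
    (f φ : ℝ → ℝ) (hf : ContinuousOn f (Set.Icc a b))
    (hφcont : ContinuousOn φ (Set.Icc a b))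
    (A : ℝ) (hA : 0 < A) (hφ : ∀ t ∈ Set.Icc a b, A ≤ |φ t|) :
    ∃ K > 0, ∀ ε > 0, ∀ x : ℝ → ℝ,
      (∀ t ∈ Set.Icc a b, DifferentiableAt ℝ x t) →
      (∀ t ∈ Set.Icc a b, |φ t * deriv x t - lam * x t - f t| ≤ ε) →
      ∃ u : ℝ → ℝ,
        (∀ t ∈ Set.Icc a b, DifferentiableAt ℝ u t) ∧
        (∀ t ∈ Set.Icc a b, φ t * deriv u t - lam * u t = f t) ∧
        (∀ t ∈ Set.Icc a b, |x t - u t| ≤ K * ε) := by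
  have hle : a ≤ b := hab.le
  set φ' : ℝ → ℝ := Set.IccExtend hle ((Set.Icc a b).domRestrict φ)
  set f' : ℝ → ℝ := Set.IccExtend hle ((Set.Icc a b).domRestrict f)
  have hφ'c : Continuous φ' := (continuousOn_iff_continuous_domRestrict.1 hφcont).Icc_extend'
  have hf'c : Continuous f' := (continuousOn_iff_continuous_domRestrict.1 hf).Icc_extend'
  have hφ'e (t : ℝ) (ht : t ∈ Set.Icc a b) : φ' t = φ t := Set.IccExtend_of_mem hle _ ht
  have hf'e (t : ℝ) (ht : t ∈ Set.Icc a b) : f' t = f t := Set.IccExtend_of_mem hle _ ht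
  have hφ'0 (t : ℝ) : φ' t ≠ 0 :=
    abs_pos.1 (hA.trans_le (hφ _ (Set.projIcc a b hle t).2))
  have hk : 0 < |lam| / A + 1 := by positivity
  refine ⟨1 / A / (|lam| / A + 1) * Real.exp ((|lam| / A + 1) * (b - a)), by positivity,
    fun ε hε x hx hxε => ?_⟩
  obtain ⟨u, hua, hu⟩ := exists_hasDerivAt_linear (p := fun t => lam / φ' t)
    (q := fun t => f' t / φ' t) (continuous_const.div hφ'c hφ'0) (hf'c.div hφ'c hφ'0) a (x a)
  have hueq (t : ℝ) (ht : t ∈ Set.Icc a b) : φ t * deriv u t - lam * u t = f t := by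
    have h0 := hφ'0 t
    rw [(hu t).deriv, ← hφ'e t ht, ← hf'e t ht]
    field_simp
    ring
  refine ⟨u, fun t _ => (hu t).differentiableAt, hueq, fun t ht => ?_⟩
  have hw : |x t - u t| ≤
      ε / A / (|lam| / A + 1) * Real.exp ((|lam| / A + 1) * (b - a)) := by
    refine abs_le_of_abs_deriv_le (w := fun t => x t - u t)
      (w' := fun t => deriv x t - deriv u t) hk (by positivity)
      (fun s hs => (hx s hs).hasDerivAt.sub (hu s).differentiableAt.hasDerivAt)
      (by simp [hua]) (fun s hs => ?_) ht
    have h1 : A * |deriv x s - deriv u s| ≤ |lam| * |x s - u s| + ε := by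
      calc A * |deriv x s - deriv u s| ≤ |φ s| * |deriv x s - deriv u s| := by
            gcongr
            exact hφ s hs
        _ = |lam * (x s - u s) + (φ s * deriv x s - lam * x s - f s)| := by
            rw [← abs_mul]
            congr 1
            linear_combination -hueq s hs
        _ ≤ |lam * (x s - u s)| + |φ s * deriv x s - lam * x s - f s| := abs_add_le _ _
        _ ≤ |lam| * |x s - u s| + ε := by
            rw [abs_mul]
            gcongr
            exact hxε s hs
    calc |deriv x s - deriv u s| ≤ (|lam| * |x s - u s| + ε) / A := by
          rw [le_div_iff₀ hA]
          linarith
      _ = |lam| / A * |x s - u s| + ε / A := by ring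
      _ ≤ (|lam| / A + 1) * |x s - u s| + ε / A := by
          gcongr
          linarith
  exact hw.trans_eq (by ring)
end

section
/- Let q > 1 be real, let λ_1, λ_2 be real numbers with 1 + λ_k·(q − 1) ≠ 0 for k = 1, 2, let m ≤ N be integers, write t_j = q^j, and let f be a real-valued function on {t_j : m ≤ j ≤ N}. For a real-valued function y on {t_j : m ≤ j ≤ N+2}, define the q-derivative (D_q y)(t) = (y(qt) − y(t))/((q − 1)·t) and (D_q² y)(t) = (D_q(D_q y))(t) (defined at t_j for m ≤ j ≤ N). Then there exists a constant K > 0 (depending only on q, m, N, λ_1, λ_2) such that for every ε > 0 and every such y satisfying |(D_q² y)(t_j) + ((1 − λ_1 − λ_2)/(q·t_j))·(D_q y)(t_j) + (λ_1 λ_2/(q·t_j²))·y(t_j) − f(t_j)| ≤ ε for all j = m, …, N, there exists a real-valued function u on {t_j : m ≤ j ≤ N+2} with (D_q² u)(t_j) + ((1 − λ_1 − λ_2)/(q·t_j))·(D_q u)(t_j) + (λ_1 λ_2/(q·t_j²))·u(t_j) = f(t_j) for all j = m, …, N, and |y(t_j) − u(t_j)| ≤ K ε for all j = m, …, N+2.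 (This is the second-order Cauchy–Euler stability theorem quoted as Theorem 1.1 of the paper, specialized to the quantum time scale q^ℤ, where σ(t) = qt, μ(t) = (q−1)t, and the regressivity condition t + λ_k μ(t) ≠ 0 becomes 1 + λ_k(q−1) ≠ 0.) -/
/-- The q-derivative: `(Dq q y) t = (y (q t) - y t) / ((q - 1) t)`. -/
noncomputable def Dq (q : ℝ) (y : ℝ → ℝ) (t : ℝ) : ℝ :=
  (y (q * t) - y t) / ((q - 1) * t)

/-- The solution with zero initial data of the recurrence `e (n + 2) = a * e (n + 1) - b * e n + r n`. -/
def forcedRecurrence (a b : ℝ) (r : ℕ → ℝ) : ℕ → ℝ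
  | 0 => 0
  | 1 => 0
  | n + 2 => a * forcedRecurrence a b r (n + 1) - b * forcedRecurrence a b r n + r n

theorem abs_forcedRecurrence_le (a b : ℝ) (r : ℕ → ℝ) {δ : ℝ} (hδ : 0 ≤ δ) (M : ℕ)
    (hr : ∀ n ≤ M, |r n| ≤ δ) :
    ∀ n ≤ M + 2, |forcedRecurrence a b r n| ≤ (|a| + |b| + 1) ^ n * δ := by
  have hD : 1 ≤ |a| + |b| + 1 := by linarith [abs_nonneg a, abs_nonneg b]
  intro n
  induction n using Nat.twoStepInduction with
  | zero => intro _; simpa [forcedRecurrence] using hδ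
  | one =>
    intro _
    simp only [forcedRecurrence, abs_zero]
    positivity
  | more n ih₀ ih₁ =>
    intro hn
    have h₀ := ih₀ (by omega)
    have h₁ := ih₁ (by omega)
    have h₂ := hr n (by omega)
    set D := |a| + |b| + 1 with hDdef
    have hmono : D ^ n * δ ≤ D ^ (n + 1) * δ := by
      gcongr
      exact Nat.le_succ n
    have hone : δ ≤ D ^ (n + 1) * δ := le_mul_of_one_le_left hδ (one_le_pow₀ hD)
    calc |forcedRecurrence a b r (n + 2)|
        ≤ |a| * |forcedRecurrence a b r (n + 1)| + |b| * |forcedRecurrence a b r n| + |r n| := by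
          rw [forcedRecurrence, ← abs_mul, ← abs_mul]
          exact (abs_add_le _ _).trans (by gcongr; exact abs_sub _ _)
      _ ≤ |a| * (D ^ (n + 1) * δ) + |b| * (D ^ (n + 1) * δ) + D ^ (n + 1) * δ := by
          gcongr
          · exact h₀.trans hmono
          · exact h₂.trans hone
      _ = D ^ (n + 2) * δ := by rw [hDdef]; ring

/-- The Cauchy–Euler `q`-difference operator as a three-term recurrence. -/
theorem cauchyEuler_eq_recurrence {q t : ℝ} (hq : 1 < q) (ht : t ≠ 0) (lam1 lam2 : ℝ)
    (y : ℝ → ℝ) :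
    Dq q (Dq q y) t + ((1 - lam1 - lam2) / (q * t)) * Dq q y t
        + (lam1 * lam2 / (q * t ^ 2)) * y t
      = (y (q * (q * t)) - ((1 + lam1 * (q - 1)) + (1 + lam2 * (q - 1))) * y (q * t)
          + (1 + lam1 * (q - 1)) * (1 + lam2 * (q - 1)) * y t) / ((q - 1) ^ 2 * q * t ^ 2) := by
  have h₁ : q - 1 ≠ 0 := by linarith
  have h₂ : q ≠ 0 := by linarith
  simp only [Dq]
  field_simp
  ring

/-- Hyers–Ulam stability of the second-order Cauchy–Euler q-difference equation on the
quantum time scale `q^ℤ`, at the points `t_j = q^j`, `m ≤ j ≤ N`. -/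
theorem hyers_ulam_cauchy_euler_quantum (q : ℝ) (hq : 1 < q) (lam1 lam2 : ℝ)
    (hreg1 : 1 + lam1 * (q - 1) ≠ 0) (hreg2 : 1 + lam2 * (q - 1) ≠ 0)
    (m N : ℤ) (hmN : m ≤ N) (f : ℝ → ℝ) :
    ∃ K > 0, ∀ ε > 0, ∀ y : ℝ → ℝ,
      (∀ j : ℤ, m ≤ j → j ≤ N →
          |Dq q (Dq q y) (q ^ j)
            + ((1 - lam1 - lam2) / (q * q ^ j)) * Dq q y (q ^ j)
            + (lam1 * lam2 / (q * (q ^ j) ^ 2)) * y (q ^ j) - f (q ^ j)| ≤ ε) →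
      ∃ u : ℝ → ℝ,
        (∀ j : ℤ, m ≤ j → j ≤ N →
            Dq q (Dq q u) (q ^ j)
              + ((1 - lam1 - lam2) / (q * q ^ j)) * Dq q u (q ^ j)
              + (lam1 * lam2 / (q * (q ^ j) ^ 2)) * u (q ^ j) = f (q ^ j)) ∧
        (∀ j : ℤ, m ≤ j → j ≤ N + 2 → |y (q ^ j) - u (q ^ j)| ≤ K * ε) := by
  have hq0 : 0 < q := by linarith
  have hq1 : 0 < q - 1 := by linarith
  obtain ⟨M, rfl⟩ : ∃ M : ℕ, N = m + M := ⟨(N - m).toNat, by omega⟩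
  set a := (1 + lam1 * (q - 1)) + (1 + lam2 * (q - 1)) with ha
  set b := (1 + lam1 * (q - 1)) * (1 + lam2 * (q - 1)) with hb
  set C := (q - 1) ^ 2 * q * (q ^ (m + M : ℤ)) ^ 2 with hC
  have hC0 : 0 < C := by positivity
  have hD : 1 ≤ |a| + |b| + 1 := by linarith [abs_nonneg a, abs_nonneg b]
  refine ⟨(|a| + |b| + 1) ^ (M + 2) * C, by positivity, fun ε hε y hy => ?_⟩
  let w : ℕ → ℝ := fun n => (q - 1) ^ 2 * q * (q ^ (m + n : ℤ)) ^ 2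
  let r : ℕ → ℝ := fun n =>
    y (q * (q * q ^ (m + n : ℤ))) - a * y (q * q ^ (m + n : ℤ)) + b * y (q ^ (m + n : ℤ))
      - w n * f (q ^ (m + n : ℤ))
  have hw : ∀ n, 0 < w n := fun n => by positivity
  have hr : ∀ n ≤ M, |r n| ≤ C * ε := by
    intro n hn
    have h := hy (m + n) (by omega) (by omega)
    rw [cauchyEuler_eq_recurrence hq (by positivity), ← ha, ← hb,
      div_sub' (hw n).ne', abs_div, abs_of_pos (hw n), div_le_iff₀ (hw n)] at h
    refine h.trans ?_
    rw [mul_comm]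
    gcongr
    simp only [w, hC]
    gcongr
    exact hq.le
  let e := forcedRecurrence a b r
  have hinj : Function.Injective (fun n : ℕ => q ^ (m + n : ℤ)) := fun i j hij => by
    have := zpow_right_injective₀ hq0 hq.ne' hij
    omega
  let u : ℝ → ℝ := fun t => y t - Function.extend (fun n : ℕ => q ^ (m + n : ℤ)) e 0 t
  have hu : ∀ n : ℕ, u (q ^ (m + n : ℤ)) = y (q ^ (m + n : ℤ)) - e n := fun n => by
    simp only [u]
    rw [hinj.extend_apply e 0 n]
  have hsucc : ∀ n : ℕ, q * q ^ (m + n : ℤ) = q ^ (m + (n + 1 : ℕ) : ℤ) := fun n => by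
    rw [← zpow_one_add₀ hq0.ne']
    congr 1
    push_cast
    ring
  refine ⟨u, fun j hmj _ => ?_, fun j hmj hjN => ?_⟩
  · obtain ⟨n, rfl⟩ : ∃ n : ℕ, j = m + n := ⟨(j - m).toNat, by omega⟩
    rw [cauchyEuler_eq_recurrence hq (by positivity), ← ha, ← hb, div_eq_iff (hw n).ne']
    have he : e (n + 2) = a * e (n + 1) - b * e n + r n := by
      simp only [e, forcedRecurrence]
    simp only [r, hsucc] at he
    simp only [hsucc, hu]
    simp only [w] at he
    linear_combination -he
  · obtain ⟨n, rfl⟩ : ∃ n : ℕ, j = m + n := ⟨(j - m).toNat, by omega⟩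
    rw [hu, sub_sub_cancel, mul_assoc]
    refine (abs_forcedRecurrence_le a b r (by positivity) M hr n (by omega)).trans ?_
    gcongr
    omega
end
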